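/- arXiv:1512.03489 — 3 statements merged into one kernel-verified Lean document; each statement's English description precedes it below -/
import Mathlib

section
/- (Pigeonhole bound on vertices of a doubly-traversed closed walk.) Let w = (i_1, i_2, …, i_k, i_1) be a closed walk of length k on the complete graph with vertex set [n], and suppose that every edge traversed by w is traversed at least twice, i.e., N(e, w) ≥ 2 for every e ∈ E(w). Then the number of distinct vertices visited by w satisfies card(V(w)) ≤ ⌊k/2⌋ + 1. -/
open Finset

/-- A walk with `m` steps visits at most one more vertex than it has distinct edges. -/
theorem card_image_walk_le_card_image_edge_add_one {α : Type*} [DecidableEq α]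
    (walk : ℕ → α) (m : ℕ) :
    ((Finset.range (m + 1)).image walk).card ≤
      ((Finset.range m).image fun j => s(walk j, walk (j + 1))).card + 1 := by
  induction m with
  | zero => simp
  | succ m ih =>
    rw [Finset.range_add_one (n := m + 1), Finset.image_insert]
    by_cases hmem : walk (m + 1) ∈ (Finset.range (m + 1)).image walk
    · rw [Finset.insert_eq_of_mem hmem]
      refine ih.trans (Nat.add_le_add_right (Finset.card_le_card ?_) 1)
      exact Finset.image_subset_image (Finset.range_subset_range.2 m.le_succ)
    · have hedge : s(walk m, walk (m + 1)) ∉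
          (Finset.range m).image fun j => s(walk j, walk (j + 1)) := by
        intro h
        obtain ⟨j, hj, hjm⟩ := Finset.mem_image.1 h
        have hj := Finset.mem_range.1 hj
        have hv : walk (m + 1) ∈ s(walk j, walk (j + 1)) := hjm ▸ Sym2.mem_mk_right _ _
        rcases Sym2.mem_iff.1 hv with hv | hv <;> rw [hv] at hmem
        · exact hmem (Finset.mem_image_of_mem _ (Finset.mem_range.2 (by omega)))
        · exact hmem (Finset.mem_image_of_mem _ (Finset.mem_range.2 (by omega)))
      have hcard : ((Finset.range (m + 1)).image fun j => s(walk j, walk (j + 1))).card =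
          ((Finset.range m).image fun j => s(walk j, walk (j + 1))).card + 1 := by
        rw [Finset.range_add_one, Finset.image_insert, Finset.card_insert_of_notMem hedge]
      rw [Finset.card_insert_of_notMem hmem, hcard]
      exact Nat.add_le_add_right ih 1

/-- **Pigeonhole bound on vertices of a doubly-traversed closed walk.**
Let `w = (i_1, …, i_k, i_1)` be a closed walk of length `k` on the complete graph with vertex
set `[n]` (encoded as `walk : ℕ → Fin n` with edges `{walk j, walk ((j+1) % k)}` for
`j = 0, …, k−1`, indices taken cyclically).  If every edge traversed by the walk is traversed
at least twice (in either direction), then the number of distinct vertices visited by the walk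
is at most `⌊k/2⌋ + 1`. -/
theorem closed_walk_doubly_traversed_vertex_bound (n k : ℕ) (hk : 1 ≤ k)
    (walk : ℕ → Fin n)
    (hdouble : ∀ j ∈ Finset.range k,
      2 ≤ ((Finset.range k).filter fun j' =>
          s(walk j', walk ((j' + 1) % k)) = s(walk j, walk ((j + 1) % k))).card) :
    ((Finset.range k).image walk).card ≤ k / 2 + 1 := by
  obtain ⟨m, rfl⟩ : ∃ m, k = m + 1 := ⟨k - 1, by omega⟩
  have hvertex := card_image_walk_le_card_image_edge_add_one walk m
  have hsub : ((Finset.range m).image fun j => s(walk j, walk (j + 1))) ⊆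
      (Finset.range (m + 1)).image fun j => s(walk j, walk ((j + 1) % (m + 1))) := by
    intro e he
    obtain ⟨j, hj, rfl⟩ := Finset.mem_image.1 he
    have hj := Finset.mem_range.1 hj
    refine Finset.mem_image.2 ⟨j, Finset.mem_range.2 (by omega), ?_⟩
    rw [Nat.mod_eq_of_lt (by omega : j + 1 < m + 1)]
  have hedge : ((Finset.range (m + 1)).image fun j =>
      s(walk j, walk ((j + 1) % (m + 1)))).card * 2 ≤ m + 1 := by
    conv_rhs => rw [← Finset.card_range (m + 1), Finset.card_eq_sum_card_image
      (fun j => s(walk j, walk ((j + 1) % (m + 1))))]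
    rw [← smul_eq_mul]
    refine Finset.card_nsmul_le_sum _ _ _ fun e he => ?_
    obtain ⟨j, hj, rfl⟩ := Finset.mem_image.1 he
    exact hdouble j hj
  have := Finset.card_le_card hsub
  omega
end

section
/- (Catalan-number identity, Eq. (4).) For every s ∈ ℕ, Σ_{r̄∈R_s} (2/(s+1))·(s+1)!/(r_1!·r_2!⋯r_s!) = (1/(s+1))·binomial(2s, s), the s-th Catalan number C_s. -/
open Finset

/-- `R_s`: the set of valid degree distributions of trees with `s` edges. -/
def Rset (s : ℕ) : Finset (Fin s → ℕ) :=
  (Fintype.piFinset fun _ => Finset.range (s + 2)).filter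
    fun r => (∑ j, r j = s + 1) ∧ (∑ j : Fin s, ((j : ℕ) + 1) * r j = 2 * s)

open PowerSeries in
/-- The coefficients of `(1 + X + ⋯ + X ^ (s - 1)) ^ (d + 1)` in degrees below `s`. -/
theorem coeff_geom_sum_pow (R : Type*) [CommRing R] (s d n : ℕ) (hn : n < s) :
    coeff n ((∑ j : Fin s, (X : R⟦X⟧) ^ (j : ℕ)) ^ (d + 1)) = ((d + n).choose d : R) := by
  have htrunc : (∑ j : Fin s, (X : R⟦X⟧) ^ (j : ℕ)) = (trunc s (mk 1 : R⟦X⟧) : R⟦X⟧) := by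
    ext m
    rw [Fin.sum_univ_eq_sum_range (fun j => (X : R⟦X⟧) ^ j), map_sum]
    simp [coeff_X_pow, Polynomial.coeff_coe, coeff_trunc]
  rw [htrunc, ← coeff_coe_trunc_of_lt hn, trunc_trunc_pow, coeff_coe_trunc_of_lt hn,
    mk_one_pow_eq_mk_choose_add, coeff_mk]

open PowerSeries in
/-- Compositions of `n` into `d + 1` nonnegative parts, grouped by the multiplicities of the
parts. -/
theorem sum_multinomial_filter_piAntidiag (s d n : ℕ) (hn : n < s) :
    ∑ r ∈ piAntidiag (univ : Finset (Fin s)) (d + 1) with ∑ j : Fin s, (j : ℕ) * r j = n,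
      (Nat.multinomial univ r : ℝ) = ((d + n).choose d : ℝ) := by
  rw [← coeff_geom_sum_pow ℝ s d n hn, sum_pow_eq_sum_piAntidiag, map_sum, sum_filter]
  refine sum_congr rfl fun r _ => ?_
  simp_rw [← pow_mul, prod_pow_eq_pow_sum]
  rw [← map_natCast (C (R := ℝ)), coeff_C_mul, coeff_X_pow]
  simp [eq_comm]

theorem Rset_eq_filter_piAntidiag (s : ℕ) (hs : 1 ≤ s) :
    Rset s = {r ∈ piAntidiag (univ : Finset (Fin s)) (s + 1) |
      ∑ j : Fin s, (j : ℕ) * r j = s - 1} := by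
  ext r
  simp only [Rset, mem_filter, Fintype.mem_piFinset, mem_range, mem_piAntidiag, mem_univ,
    implies_true, and_true, add_mul, one_mul, sum_add_distrib]
  constructor
  · rintro ⟨-, h, h'⟩
    exact ⟨h, by omega⟩
  · rintro ⟨h : ∑ j, r j = s + 1, h'⟩
    refine ⟨fun j => ?_, h, by omega⟩
    have := single_le_sum (fun i _ => Nat.zero_le (r i)) (mem_univ j)
    omega

/-- **Catalan-number identity, Eq. (4).** For every `s ∈ ℕ`,
`Σ_{r̄∈R_s} (2/(s+1))·(s+1)!/(r_1!·r_2!⋯r_s!) = (1/(s+1))·binomial(2s, s)`,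
the `s`-th Catalan number `C_s`. -/
theorem sum_multinomial_over_tree_degree_distributions (s : ℕ) (hs : 1 ≤ s) :
    ∑ r ∈ Rset s, (2 / ((s : ℝ) + 1)) *
        ((Nat.factorial (s + 1) : ℝ) / ∏ j, (Nat.factorial (r j) : ℝ))
      = (1 / ((s : ℝ) + 1)) * (Nat.choose (2 * s) s : ℝ) := by
  have hterm : ∀ r ∈ Rset s, (Nat.factorial (s + 1) : ℝ) / ∏ j, (Nat.factorial (r j) : ℝ)
      = (Nat.multinomial univ r : ℝ) := by
    intro r hr
    have hspec := Nat.multinomial_spec (univ : Finset (Fin s)) r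
    rw [(mem_filter.1 hr).2.1] at hspec
    rw [div_eq_iff (prod_ne_zero_iff.2 fun j _ => by positivity), mul_comm]
    exact_mod_cast hspec.symm
  have hchoose : (2 * s).choose s = 2 * (s + (s - 1)).choose s := by
    obtain ⟨t, rfl⟩ := Nat.exists_eq_add_of_le' hs
    rw [show 2 * (t + 1) = t + 1 + t + 1 by ring, Nat.choose_succ_succ, Nat.add_sub_cancel,
      Nat.choose_symm_add, two_mul]
  rw [← mul_sum, sum_congr rfl hterm, Rset_eq_filter_piAntidiag s hs,
    sum_multinomial_filter_piAntidiag s s (s - 1) (by omega), hchoose]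
  push_cast
  ring
end

section
/- (Catalan bound on the limiting moments and Carleman's criterion.) Suppose Λ_j ≥ 0 for all j and there exists L > 0 with Λ_j ≤ L^j for every j. Then for every s ∈ ℕ, m_{2s} = Σ_{r∈R_s} (2/(s+1))·(s+1)!/(r_1!⋯r_s!)·Λ_1^{r_1}⋯Λ_s^{r_s} ≤ (1/(s+1))·binomial(2s, s)·L^{2s} ≤ (2L)^{2s}; consequently Σ_{s=1}^∞ m_{2s}^{−1/(2s)} = ∞ whenever the m_{2s} are all positive, i.e., the moment sequence (m_k) with m_{2s+1} = 0 satisfies Carleman's criterion and hence determines a unique probability distribution. -/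
open Finset Filter MeasureTheory

noncomputable section

/-- The even limiting spectral moments
`m_{2s} = Σ_{r∈R_s} (2/(s+1))·(s+1)!/(r_1!⋯r_s!)·Λ_1^{r_1}⋯Λ_s^{r_s}`. -/
def momEven (Λ : ℕ → ℝ) (s : ℕ) : ℝ :=
  ∑ r ∈ Rset s, (2 / ((s : ℝ) + 1)) *
    ((Nat.factorial (s + 1) : ℝ) / ∏ j, (Nat.factorial (r j) : ℝ)) *
    ∏ j : Fin s, Λ ((j : ℕ) + 1) ^ (r j)

/-- The limiting spectral moments: `m_{2s}` as above and `m_{2s+1} = 0`. -/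
def mom (Λ : ℕ → ℝ) (k : ℕ) : ℝ := if Even k then momEven Λ (k / 2) else 0

open PowerSeries in
/-- The compositions of `2s` into `s + 1` positive parts, counted by the multiplicities of the
parts, number `binomial(2s-1, s)`. -/
lemma sum_multinomial_Rset {s : ℕ} (hs : 1 ≤ s) :
    ∑ r ∈ Rset s, Nat.multinomial univ r = (2 * s - 1).choose s := by
  have hR : Rset s = ((univ : Finset (Fin s)).piAntidiag (s + 1)).filter
      fun r => s - 1 = ∑ j : Fin s, (j : ℕ) * r j := by
    ext r
    have hw : ∑ j : Fin s, ((j : ℕ) + 1) * r j = ∑ j : Fin s, (j : ℕ) * r j + ∑ j, r j := by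
      simp only [add_mul, one_mul, sum_add_distrib]
    simp only [Rset, mem_filter, Fintype.mem_piFinset, mem_range, mem_piAntidiag, mem_univ,
      implies_true, and_true, hw]
    constructor
    · rintro ⟨-, h1, h2⟩
      exact ⟨h1, by omega⟩
    · rintro ⟨h1, h2⟩
      replace h1 : ∑ j, r j = s + 1 := h1
      refine ⟨fun i => ?_, h1, by omega⟩
      have := single_le_sum (f := r) (fun _ _ => Nat.zero_le _) (mem_univ i)
      omega
  have hcoeff : coeff (s - 1) ((∑ j : Fin s, (X : ℤ⟦X⟧) ^ (j : ℕ)) ^ (s + 1))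
      = ((∑ r ∈ Rset s, Nat.multinomial univ r : ℕ) : ℤ) := by
    rw [sum_pow_eq_sum_piAntidiag, map_sum, hR, sum_filter, Nat.cast_sum]
    refine sum_congr rfl fun r _ => ?_
    simp_rw [← pow_mul]
    rw [prod_pow_eq_pow_sum, ← map_natCast (C (R := ℤ)), coeff_C_mul, coeff_X_pow]
    split_ifs <;> simp
  have hdvd : (X : ℤ⟦X⟧) ^ s ∣ (∑ j : Fin s, (X : ℤ⟦X⟧) ^ (j : ℕ)) - PowerSeries.mk 1 := by
    rw [X_pow_dvd_iff]
    intro m hm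
    rw [Fin.sum_univ_eq_sum_range (fun j => (X : ℤ⟦X⟧) ^ j) s]
    simp [coeff_X_pow, hm]
  have hpow := (X_pow_dvd_iff.1 (hdvd.trans (sub_dvd_pow_sub_pow _ _ (s + 1)))) (s - 1) (by omega)
  rw [map_sub, hcoeff, mk_one_pow_eq_mk_choose_add, coeff_mk, sub_eq_zero] at hpow
  rw [show 2 * s - 1 = s + (s - 1) by omega]
  exact_mod_cast hpow

lemma momEven_le {Λ : ℕ → ℝ} (hΛ : ∀ j, 0 ≤ Λ j) {L : ℝ}
    (hΛL : ∀ j : ℕ, Λ j ≤ L ^ j) {s : ℕ} (hs : 1 ≤ s) :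
    momEven Λ s ≤ (1 / ((s : ℝ) + 1)) * (Nat.choose (2 * s) s : ℝ) * L ^ (2 * s) := by
  have hterm : ∀ r ∈ Rset s, (2 / ((s : ℝ) + 1)) *
      ((Nat.factorial (s + 1) : ℝ) / ∏ j, (Nat.factorial (r j) : ℝ)) *
      ∏ j : Fin s, Λ ((j : ℕ) + 1) ^ (r j) ≤
      (2 / ((s : ℝ) + 1)) * (Nat.multinomial univ r : ℝ) * L ^ (2 * s) := by
    intro r hr
    obtain ⟨-, h1, h2⟩ := mem_filter.1 hr
    have hm : (Nat.factorial (s + 1) : ℝ) / ∏ j, (Nat.factorial (r j) : ℝ)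
        = (Nat.multinomial univ r : ℝ) := by
      rw [div_eq_iff (prod_ne_zero_iff.2 fun j _ => Nat.cast_ne_zero.2 (Nat.factorial_ne_zero _)),
        ← h1, ← Nat.multinomial_spec univ r]
      push_cast
      ring
    rw [hm]
    gcongr
    calc ∏ j : Fin s, Λ ((j : ℕ) + 1) ^ (r j)
        ≤ ∏ j : Fin s, (L ^ ((j : ℕ) + 1)) ^ (r j) :=
          prod_le_prod (fun j _ => pow_nonneg (hΛ _) _)
            fun j _ => pow_le_pow_left₀ (hΛ _) (hΛL _) _
      _ = L ^ (2 * s) := by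
          simp_rw [← pow_mul]
          rw [prod_pow_eq_pow_sum, h2]
  have hchoose : (2 * s).choose s = 2 * (2 * s - 1).choose s := by
    obtain ⟨n, rfl⟩ : ∃ n, s = n + 1 := ⟨s - 1, by omega⟩
    rw [show 2 * (n + 1) = (2 * n + 1) + 1 by ring, Nat.choose_succ_succ, Nat.add_sub_cancel,
      Nat.choose_symm_half]
    ring
  refine (sum_le_sum hterm).trans_eq ?_
  rw [← sum_mul, ← mul_sum, ← Nat.cast_sum, sum_multinomial_Rset hs, hchoose]
  push_cast
  ring

lemma catalan_mul_pow_le (s : ℕ) {L : ℝ} (hL : 0 ≤ L) :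
    (1 / ((s : ℝ) + 1)) * (Nat.choose (2 * s) s : ℝ) * L ^ (2 * s) ≤ (2 * L) ^ (2 * s) := by
  rw [mul_pow]
  gcongr
  have h1 : (1 / ((s : ℝ) + 1)) ≤ 1 := by
    rw [div_le_one (by positivity)]
    linarith [s.cast_nonneg (α := ℝ)]
  have h2 : (Nat.choose (2 * s) s : ℝ) ≤ 2 ^ (2 * s) := by
    exact_mod_cast Nat.choose_le_two_pow (2 * s) s
  calc _ ≤ 1 * (Nat.choose (2 * s) s : ℝ) := by gcongr
    _ ≤ _ := by simpa using h2

/-- A sequence of positive numbers `a s ≤ C ^ (2s)` satisfies Carleman's condition. -/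
lemma tendsto_sum_rpow_neg_atTop {a : ℕ → ℝ} {C : ℝ} (hC : 0 < C)
    (hpos : ∀ s, 1 ≤ s → 0 < a s) (hle : ∀ s, 1 ≤ s → a s ≤ C ^ (2 * s)) :
    Tendsto (fun N : ℕ => ∑ s ∈ Icc 1 N, a s ^ (-(1 / (2 * (s : ℝ))))) atTop atTop := by
  have hlow : ∀ N : ℕ, (N : ℝ) * C⁻¹ ≤ ∑ s ∈ Icc 1 N, a s ^ (-(1 / (2 * (s : ℝ)))) := by
    intro N
    have := card_nsmul_le_sum (Icc 1 N) (fun s : ℕ => a s ^ (-(1 / (2 * (s : ℝ))))) C⁻¹ ?_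
    · simpa using this
    intro s hs
    have hs1 : 1 ≤ s := (mem_Icc.1 hs).1
    have hs0 : (0 : ℝ) < s := by exact_mod_cast hs1
    calc C⁻¹ = (C ^ (2 * s)) ^ (-(1 / (2 * (s : ℝ)))) := by
          rw [← Real.rpow_natCast, ← Real.rpow_mul hC.le, ← Real.rpow_neg_one]
          congr 1
          push_cast
          field_simp
      _ ≤ _ := Real.rpow_le_rpow_of_nonpos (hpos s hs1) (hle s hs1)
          (neg_nonpos.2 (by positivity))
  exact tendsto_atTop_mono hlow
    (tendsto_natCast_atTop_atTop.atTop_mul_const (inv_pos.2 hC))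

/-- A measure whose even moments are finite and bounded by `C ^ (2s)` lives on `[-C, C]`. -/
lemma ae_abs_le_of_even_moments_le {μ : Measure ℝ} [IsFiniteMeasure μ] {C : ℝ} (hC : 0 < C)
    (hint : ∀ s, 1 ≤ s → Integrable (fun x : ℝ => x ^ (2 * s)) μ)
    (hle : ∀ s, 1 ≤ s → ∫ x, x ^ (2 * s) ∂μ ≤ C ^ (2 * s)) :
    ∀ᵐ x ∂μ, |x| ≤ C := by
  have hnull : ∀ R, C < R → ∀ᵐ x ∂μ, |x| < R := by
    intro R hR
    have hR0 : 0 < R := hC.trans hR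
    have hbound : ∀ s : ℕ, 1 ≤ s → μ.real {x | R ≤ |x|} ≤ ((C / R) ^ 2) ^ s := by
      intro s hs
      have hmarkov := mul_meas_ge_le_integral_of_nonneg
        (ae_of_all μ fun x : ℝ => (even_two_mul s).pow_nonneg x) (hint s hs) (R ^ (2 * s))
      have hset : {x : ℝ | R ^ (2 * s) ≤ x ^ (2 * s)} = {x | R ≤ |x|} := by
        ext x
        rw [Set.mem_ofPred_eq, Set.mem_ofPred_eq, ← (even_two_mul s).pow_abs x,
          pow_le_pow_iff_left₀ hR0.le (abs_nonneg x) (by omega)]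
      rw [hset] at hmarkov
      rw [← pow_mul, div_pow, le_div_iff₀' (by positivity)]
      exact hmarkov.trans (hle s hs)
    have hlt : (C / R) ^ 2 < 1 :=
      pow_lt_one₀ (by positivity) ((div_lt_one hR0).2 hR) two_ne_zero
    have hzero : μ.real {x | R ≤ |x|} ≤ 0 :=
      ge_of_tendsto (tendsto_pow_atTop_nhds_zero_of_lt_one (by positivity) hlt)
        ((eventually_ge_atTop 1).mono hbound)
    have hmeas : μ {x | R ≤ |x|} = 0 :=
      (measureReal_eq_zero_iff).1 (le_antisymm hzero measureReal_nonneg)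
    simpa [ae_iff] using hmeas
  have hall : ∀ᵐ x ∂μ, ∀ n : ℕ, |x| < C + 1 / ((n : ℝ) + 1) :=
    ae_all_iff.2 fun n => hnull _ (lt_add_of_pos_right _ (by positivity))
  filter_upwards [hall] with x hx
  have hlim : Tendsto (fun n : ℕ => C + 1 / ((n : ℝ) + 1)) atTop (nhds (C + 0)) :=
    tendsto_one_div_add_atTop_nhds_zero_nat.const_add C
  rw [add_zero] at hlim
  exact ge_of_tendsto' hlim fun n => (hx n).le

/-- The characteristic function of a compactly supported law is the sum of its moment series. -/
lemma hasSum_charFun_of_ae_abs_le {μ : Measure ℝ} [IsProbabilityMeasure μ] {C : ℝ}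
    (hμ : ∀ᵐ x ∂μ, |x| ≤ C) (t : ℝ) :
    HasSum (fun n : ℕ => ((t : ℂ) * Complex.I) ^ n / (n.factorial : ℂ) *
      ((∫ x, x ^ n ∂μ : ℝ) : ℂ)) (charFun μ t) := by
  set f : ℕ → ℝ → ℂ := fun n x => ((t : ℂ) * Complex.I) ^ n / (n.factorial : ℂ) * ((x ^ n : ℝ) : ℂ)
    with hf
  have hbound : ∀ n, ∀ᵐ x ∂μ, ‖f n x‖ ≤ (|t| * C) ^ n / (n.factorial : ℝ) := by
    intro n
    filter_upwards [hμ] with x hx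
    have hnorm : ‖f n x‖ = |t| ^ n / (n.factorial : ℝ) * |x| ^ n := by simp [hf]
    rw [hnorm, mul_pow, mul_div_right_comm]
    gcongr
  have hint : ∀ n, Integrable (f n) μ := fun n =>
    Integrable.of_bound (by fun_prop) _ (hbound n)
  have hsum : Summable fun n => ∫ x, ‖f n x‖ ∂μ := by
    refine Summable.of_nonneg_of_le (fun n => integral_nonneg fun x => norm_nonneg _) (fun n => ?_)
      (Real.summable_pow_div_factorial (|t| * C))
    simpa using integral_mono_ae (hint n).norm (integrable_const _) (hbound n)
  have hexp : ∀ x : ℝ, ∑' n, f n x = Complex.exp (t * x * Complex.I) := by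
    intro x
    rw [Complex.exp_eq_exp_ℂ, ← (NormedSpace.expSeries_div_hasSum_exp _).tsum_eq]
    refine tsum_congr fun n => ?_
    simp only [hf, Complex.ofReal_pow]
    ring
  have hmain := hasSum_integral_of_summable_integral_norm hint hsum
  simp_rw [hexp, hf, integral_const_mul, integral_complex_ofReal] at hmain
  rwa [charFun_apply_real]

/-- Compactly supported laws on the line are determined by their moments. -/
lemma ext_of_moments_of_ae_abs_le {μ ν : Measure ℝ} [IsProbabilityMeasure μ]
    [IsProbabilityMeasure ν] {C : ℝ} (hμ : ∀ᵐ x ∂μ, |x| ≤ C)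
    (hν : ∀ᵐ x ∂ν, |x| ≤ C) (h : ∀ k : ℕ, 1 ≤ k → ∫ x, x ^ k ∂μ = ∫ x, x ^ k ∂ν) : μ = ν := by
  refine Measure.ext_of_charFun (funext fun t => ?_)
  have hmom : ∀ k : ℕ, ∫ x, x ^ k ∂μ = ∫ x, x ^ k ∂ν := by
    intro k
    rcases Nat.eq_zero_or_pos k with rfl | hk
    · simp
    · exact h k hk
  have hsum := hasSum_charFun_of_ae_abs_le hμ t
  simp_rw [hmom] at hsum
  exact hsum.unique (hasSum_charFun_of_ae_abs_le hν t)

/-- **Catalan bound on the limiting moments and Carleman's criterion.**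
If `0 ≤ Λ_j ≤ L^j` for all `j`, then `m_{2s} ≤ (1/(s+1))·binomial(2s,s)·L^{2s} ≤ (2L)^{2s}`;
consequently `Σ_{s≥1} m_{2s}^{−1/(2s)} = ∞` whenever the `m_{2s}` are all positive, i.e. the
moment sequence `(m_k)` with `m_{2s+1} = 0` satisfies Carleman's criterion and hence determines
a unique probability distribution. -/
theorem catalan_bound_and_carleman (Λ : ℕ → ℝ) (hΛ : ∀ j, 0 ≤ Λ j)
    (L : ℝ) (hL : 0 < L) (hΛL : ∀ j : ℕ, Λ j ≤ L ^ j) :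
    (∀ s : ℕ, 1 ≤ s →
      momEven Λ s ≤ (1 / ((s : ℝ) + 1)) * (Nat.choose (2 * s) s : ℝ) * L ^ (2 * s) ∧
      (1 / ((s : ℝ) + 1)) * (Nat.choose (2 * s) s : ℝ) * L ^ (2 * s) ≤ (2 * L) ^ (2 * s)) ∧
    ((∀ s : ℕ, 1 ≤ s → 0 < momEven Λ s) →
      -- Carleman's criterion: Σ_{s≥1} m_{2s}^{−1/(2s)} = ∞
      Tendsto (fun N : ℕ =>
          ∑ s ∈ Finset.Icc 1 N, momEven Λ s ^ (-(1 / (2 * (s : ℝ)))))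
        atTop atTop ∧
      -- hence the moment sequence determines a unique probability distribution
      ∀ F G : Measure ℝ, IsProbabilityMeasure F → IsProbabilityMeasure G →
        (∀ k : ℕ, 1 ≤ k → ∫ x, x ^ k ∂F = mom Λ k) →
        (∀ k : ℕ, 1 ≤ k → ∫ x, x ^ k ∂G = mom Λ k) → F = G) := by
  have hbound : ∀ s : ℕ, 1 ≤ s → momEven Λ s ≤ (2 * L) ^ (2 * s) := fun s hs =>
    (momEven_le hΛ hΛL hs).trans (catalan_mul_pow_le s hL.le)
  refine ⟨fun s hs => ⟨momEven_le hΛ hΛL hs, catalan_mul_pow_le s hL.le⟩, fun hpos =>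
    ⟨tendsto_sum_rpow_neg_atTop (by positivity) hpos hbound, ?_⟩⟩
  intro F G _ _ hF hG
  have hsupp : ∀ μ : Measure ℝ, IsProbabilityMeasure μ →
      (∀ k : ℕ, 1 ≤ k → ∫ x, x ^ k ∂μ = mom Λ k) → ∀ᵐ x ∂μ, |x| ≤ 2 * L := by
    intro μ _ hμ
    have heven : ∀ s : ℕ, 1 ≤ s → ∫ x, x ^ (2 * s) ∂μ = momEven Λ s := fun s hs => by
      rw [hμ _ (by omega)]
      simp [mom]
    refine ae_abs_le_of_even_moments_le (by positivity) (fun s hs => ?_) fun s hs =>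
      (heven s hs).trans_le (hbound s hs)
    exact Integrable.of_integral_ne_zero (heven s hs ▸ (hpos s hs).ne')
  exact ext_of_moments_of_ae_abs_le (hsupp F ‹_› hF) (hsupp G ‹_› hG)
    fun k hk => (hF k hk).trans (hG k hk).symm

end
end
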